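/- Sharp two-sided bounds near extinction: let H be a real Hilbert space, J : H → [0,∞] proper, convex, lower semicontinuous and absolutely 1-homogeneous, coercive with constant λ₁ > 0. Let u₀ ∈ H with u₀ ⊥ N(J), let u be a strong solution of the gradient flow with initial datum u₀, and let T_ex := inf{ T ≥ 0 : u(t) = 0 for all t ≥ T } (which is finite). Then for every t ∈ [0, T_ex) with u(t) ≠ 0 one has λ₁·(T_ex − t) ≤ ‖u(t)‖ ≤ (J(u(t))/‖u(t)‖)·(T_ex − t). -/

import Mathlib

open MeasureTheory Filter Topology
open scoped ENNReal RealInnerProductSpace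

variable {H : Type*} [NormedAddCommGroup H] [InnerProductSpace ℝ H] [CompleteSpace H]

/-- `J` is proper: it is not identically `+∞`. -/
def IsProperFn (J : H → ℝ≥0∞) : Prop := ∃ u, J u ≠ ⊤

/-- Convexity of an `[0,∞]`-valued functional. -/
def IsConvexFn (J : H → ℝ≥0∞) : Prop :=
  ∀ (x y : H) (a b : ℝ), 0 ≤ a → 0 ≤ b → a + b = 1 →
    J (a • x + b • y) ≤ ENNReal.ofReal a * J x + ENNReal.ofReal b * J y

/-- Absolute 1-homogeneity: `J(λu) = |λ|·J(u)`. -/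
def AbsOneHomogeneous (J : H → ℝ≥0∞) : Prop :=
  ∀ (c : ℝ) (u : H), J (c • u) = ENNReal.ofReal |c| * J u

/-- The null space `N(J) = {w : J(w) = 0}`. -/
def NullSpace (J : H → ℝ≥0∞) : Set H := {w | J w = 0}

/-- `u ⊥ N(J)`. -/
def PerpNullSpace (J : H → ℝ≥0∞) (u : H) : Prop := ∀ w ∈ NullSpace J, ⟪u, w⟫ = 0

/-- Coercivity with constant `λ₁`: `λ₁‖w‖ ≤ J(w)` for every `w ⊥ N(J)`. -/
def CoerciveWith (J : H → ℝ≥0∞) (lam : ℝ) : Prop :=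
  ∀ w : H, PerpNullSpace J w → ENNReal.ofReal (lam * ‖w‖) ≤ J w

/-- `v ∈ ∂J(u)`: the subdifferential inequality `J(w) ≥ J(u) + ⟨v, w − u⟩` for all `w`. -/
def MemSubdiffFn (J : H → ℝ≥0∞) (u v : H) : Prop :=
  ∀ w : H, (J u : EReal) + ((⟪v, w - u⟫ : ℝ) : EReal) ≤ (J w : EReal)

/-- A strong solution of the gradient flow `u' ∈ −∂J(u)`: continuous on `[0,∞)`,
locally absolutely continuous on `(0,∞)` (encoded by the fundamental theorem of
calculus with a locally integrable a.e. derivative `u'`), differentiable a.e. with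
`−u'(t) ∈ ∂J(u(t))` for a.e. `t > 0`. -/
structure GradientFlowSol (J : H → ℝ≥0∞) where
  u : ℝ → H
  u' : ℝ → H
  cont : ContinuousOn u (Set.Ici 0)
  locint : ∀ s t : ℝ, 0 < s → s ≤ t → IntervalIntegrable u' volume s t
  fund : ∀ s t : ℝ, 0 < s → s ≤ t → u t - u s = ∫ r in s..t, u' r
  deriv_ae : ∀ᵐ t : ℝ, 0 < t → HasDerivAt u (u' t) t
  subdiff_ae : ∀ᵐ t : ℝ, 0 < t → MemSubdiffFn J (u t) (-u' t)

omit [CompleteSpace H] in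
/-- The dual bound `⟪v, w⟫ ≤ J w` for a subgradient of an absolutely 1-homogeneous functional,
together with Euler's identity `⟪v, u⟫ = J u`. -/
lemma MemSubdiffFn.euler_and_inner_le {J : H → ℝ≥0∞} (hhom : AbsOneHomogeneous J) {u v : H}
    (h : MemSubdiffFn J u v) :
    J u ≠ ⊤ ∧ ⟪v, u⟫ = (J u).toReal ∧ ∀ w, J w ≠ ⊤ → ⟪v, w⟫ ≤ (J w).toReal := by
  have h0 : J 0 = 0 := by simpa using hhom 0 0
  have hu : J u ≠ ⊤ := by
    intro hu
    have := h 0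
    rw [hu, h0] at this
    simp at this
  have key : ∀ w, J w ≠ ⊤ → (J u).toReal + ⟪v, w - u⟫ ≤ (J w).toReal := by
    intro w hw
    have := h w
    rw [← ENNReal.ofReal_toReal hu, ← ENNReal.ofReal_toReal hw,
      EReal.coe_ennreal_ofReal, EReal.coe_ennreal_ofReal,
      max_eq_left ENNReal.toReal_nonneg, max_eq_left ENNReal.toReal_nonneg] at this
    exact_mod_cast this
  have h2 : J ((2 : ℝ) • u) = 2 * J u := by
    rw [hhom]; norm_num
  have euler : ⟪v, u⟫ = (J u).toReal := by
    have k0 := key 0 (by simp [h0])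
    have k2 := key ((2 : ℝ) • u) (by rw [h2]; exact ENNReal.mul_ne_top (by simp) hu)
    rw [h2, ENNReal.toReal_mul, two_smul, add_sub_cancel_right] at k2
    rw [h0, zero_sub, inner_neg_right] at k0
    norm_num at k0 k2
    linarith
  refine ⟨hu, euler, fun w hw => ?_⟩
  have := key w hw
  rw [inner_sub_right, euler] at this
  linarith

/-- A function whose increments are dominated by those of an absolutely continuous function is
absolutely continuous. -/
lemma AbsolutelyContinuousOnInterval.of_dist_le {X Y : Type*} [PseudoMetricSpace X]
    [PseudoMetricSpace Y] {f : ℝ → X} {F : ℝ → Y} {a b : ℝ}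
    (hF : AbsolutelyContinuousOnInterval F a b)
    (h : ∀ x ∈ Set.uIcc a b, ∀ y ∈ Set.uIcc a b, dist (f x) (f y) ≤ dist (F x) (F y)) :
    AbsolutelyContinuousOnInterval f a b := by
  rw [absolutelyContinuousOnInterval_iff] at hF ⊢
  intro ε hε
  obtain ⟨δ, hδ, H⟩ := hF ε hε
  refine ⟨δ, hδ, fun E hE hlt => lt_of_le_of_lt (Finset.sum_le_sum fun i hi => ?_) (H E hE hlt)⟩
  have := hE.1 i hi
  exact h _ this.1 _ this.2

namespace GradientFlowSol

variable {J : H → ℝ≥0∞} (S : GradientFlowSol J)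

omit [CompleteSpace H] in
lemma tendsto_nhdsGT {a : ℝ} (ha : 0 ≤ a) : Tendsto S.u (𝓝[>] a) (𝓝 (S.u a)) :=
  (S.cont a ha).mono_left (nhdsWithin_mono a fun _ hx => ha.trans (le_of_lt hx))

/-- Integration of a bound on `⟪-u', w⟫` along the flow. -/
lemma inner_sub_le {w : H} {c : ℝ} (h : ∀ᵐ r : ℝ, 0 < r → ⟪-S.u' r, w⟫ ≤ c) {a b : ℝ}
    (ha : 0 ≤ a) (hab : a ≤ b) : ⟪S.u a - S.u b, w⟫ ≤ c * (b - a) := by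
  have pos : ∀ a : ℝ, 0 < a → a ≤ b → ⟪S.u a - S.u b, w⟫ ≤ c * (b - a) := by
    intro a ha hab
    have hint := S.locint a b ha hab
    have e : ⟪S.u a - S.u b, w⟫ = ∫ r in a..b, ⟪-S.u' r, w⟫ := by
      rw [← neg_sub, S.fund a b ha hab, ← intervalIntegral.integral_neg, real_inner_comm]
      have := (innerSL ℝ w).intervalIntegral_comp_comm hint.neg
      simp only [innerSL_apply_apply] at this
      simp only [real_inner_comm w]
      exact this.symm
    have hi : IntervalIntegrable (fun r => ⟪-S.u' r, w⟫) volume a b := by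
      simp only [real_inner_comm w]
      exact ⟨(innerSL ℝ w).integrable_comp hint.neg.1, (innerSL ℝ w).integrable_comp hint.neg.2⟩
    calc ⟪S.u a - S.u b, w⟫ = ∫ r in a..b, ⟪-S.u' r, w⟫ := e
      _ ≤ ∫ _ in a..b, c := by
        refine intervalIntegral.integral_mono_ae_restrict hab hi intervalIntegrable_const ?_
        filter_upwards [ae_restrict_of_ae h, ae_restrict_mem measurableSet_Icc] with r hr hm
        exact hr (ha.trans_le hm.1)
      _ = c * (b - a) := by simp [mul_comm]
  rcases hab.eq_or_lt with rfl | hlt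
  · simp
  refine le_of_tendsto_of_tendsto (b := 𝓝[>] a)
    (((S.tendsto_nhdsGT ha).sub tendsto_const_nhds).inner tendsto_const_nhds)
    ((tendsto_const_nhds.sub (tendsto_id.mono_left nhdsWithin_le_nhds)).const_mul c) ?_
  filter_upwards [Ioo_mem_nhdsGT hlt] with x hx
  exact pos x (ha.trans_lt hx.1) hx.2.le

omit [CompleteSpace H] in
lemma absolutelyContinuousOnInterval_norm {a b : ℝ} (ha : 0 < a) (hab : a ≤ b) :
    AbsolutelyContinuousOnInterval (fun r => ‖S.u r‖) a b := by
  have hint := (S.locint a b ha hab).norm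
  refine (hint.absolutelyContinuousOnInterval_intervalIntegral Set.left_mem_uIcc).of_dist_le ?_
  rw [Set.uIcc_of_le hab]
  have key : ∀ x ∈ Set.Icc a b, ∀ y ∈ Set.Icc a b, x ≤ y → dist (‖S.u x‖) (‖S.u y‖) ≤
      dist (∫ v in a..x, ‖S.u' v‖) (∫ v in a..y, ‖S.u' v‖) := by
    intro x hx y hy hxy
    have hx0 : 0 < x := ha.trans_le hx.1
    rw [dist_comm, dist_comm (∫ v in a..x, ‖S.u' v‖), Real.dist_eq, Real.dist_eq,
      intervalIntegral.integral_interval_sub_left (S.locint a y ha hy.1).norm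
        (S.locint a x ha hx.1).norm]
    calc |‖S.u y‖ - ‖S.u x‖| ≤ ‖S.u y - S.u x‖ := abs_norm_sub_norm_le _ _
      _ = ‖∫ v in x..y, S.u' v‖ := by rw [S.fund x y hx0 hxy]
      _ ≤ _ := intervalIntegral.norm_integral_le_abs_integral_norm
  intro x hx y hy
  rcases le_total x y with h | h
  · exact key x hx y hy h
  · rw [dist_comm, dist_comm (∫ v in a..x, ‖S.u' v‖)]
    exact key y hy x hx h

omit [CompleteSpace H] in
lemma norm_sub_le_of_deriv_le {a b c : ℝ} (ha : 0 ≤ a) (hab : a ≤ b)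
    (h : ∀ᵐ r : ℝ, a < r → r ≤ b → deriv (fun r => ‖S.u r‖) r ≤ c) :
    ‖S.u b‖ - ‖S.u a‖ ≤ c * (b - a) := by
  rcases hab.eq_or_lt with rfl | hlt
  · simp
  refine le_of_tendsto_of_tendsto (b := 𝓝[>] a)
    (tendsto_const_nhds.sub (S.tendsto_nhdsGT ha).norm)
    ((tendsto_const_nhds.sub (tendsto_id.mono_left nhdsWithin_le_nhds)).const_mul c) ?_
  filter_upwards [Ioo_mem_nhdsGT hlt] with x hx
  have hac := S.absolutelyContinuousOnInterval_norm (ha.trans_lt hx.1) hx.2.le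
  calc ‖S.u b‖ - ‖S.u x‖ = ∫ r in x..b, deriv (fun r => ‖S.u r‖) r :=
        hac.integral_deriv_eq_sub.symm
    _ ≤ ∫ _ in x..b, c := by
      refine intervalIntegral.integral_mono_ae_restrict hx.2.le hac.intervalIntegrable_deriv
        intervalIntegrable_const ?_
      filter_upwards [ae_restrict_of_ae h, ae_restrict_mem measurableSet_Icc] with r hr hm
      exact hr (hx.1.trans_le hm.1) hm.2
    _ = c * (b - x) := by simp [mul_comm]

lemma perpNullSpace (hhom : AbsOneHomogeneous J) (h0 : PerpNullSpace J (S.u 0)) {t : ℝ}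
    (ht : 0 ≤ t) : PerpNullSpace J (S.u t) := by
  have key : ∀ w ∈ NullSpace J, 0 ≤ ⟪S.u t, w⟫ := by
    intro w hw
    have hw' : J w = 0 := hw
    have := S.inner_sub_le (w := w) (c := 0) (by
      filter_upwards [S.subdiff_ae] with r hr hr0
      simpa [hw'] using ((hr hr0).euler_and_inner_le hhom).2.2 w (by simp [hw'])) le_rfl ht
    rw [inner_sub_left, h0 w hw] at this
    linarith
  intro w hw
  refine le_antisymm ?_ (key w hw)
  have hn : -w ∈ NullSpace J := by
    have := hhom (-1) w
    rw [show J w = 0 from hw] at this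
    simpa [NullSpace] using this
  have := key _ hn
  rw [inner_neg_right] at this
  linarith

/-- Along the flow, `‖u‖' = -J(u) / ‖u‖ ≤ -λ` wherever `u ≠ 0`. -/
lemma deriv_norm_le (hhom : AbsOneHomogeneous J) {lam : ℝ} (hcoer : CoerciveWith J lam)
    (h0 : PerpNullSpace J (S.u 0)) :
    ∀ᵐ r : ℝ, 0 < r → S.u r ≠ 0 → deriv (fun r => ‖S.u r‖) r ≤ -lam := by
  filter_upwards [S.deriv_ae, S.subdiff_ae] with r hd hs hr hne
  obtain ⟨hfin, euler, -⟩ := (hs hr).euler_and_inner_le hhom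
  have hpos : 0 < ‖S.u r‖ := norm_pos_iff.2 hne
  have hco : lam * ‖S.u r‖ ≤ (J (S.u r)).toReal :=
    (ENNReal.ofReal_le_iff_le_toReal hfin).1 (hcoer _ (S.perpNullSpace hhom h0 hr.le))
  have hder := (hd hr).norm_sq.sqrt (by positivity)
  simp only [Real.sqrt_sq (norm_nonneg _)] at hder
  rw [hder.deriv, div_le_iff₀ (by positivity)]
  rw [inner_neg_left, real_inner_comm] at euler
  linarith

lemma norm_antitoneOn (hhom : AbsOneHomogeneous J) {lam : ℝ} (hlam : 0 ≤ lam)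
    (hcoer : CoerciveWith J lam) (h0 : PerpNullSpace J (S.u 0)) :
    AntitoneOn (fun r => ‖S.u r‖) (Set.Ici 0) := by
  intro a ha b _ hab
  have := S.norm_sub_le_of_deriv_le (c := 0) ha hab (by
    filter_upwards [S.deriv_norm_le hhom hcoer h0] with r hr har _
    by_cases hz : S.u r = 0
    · refine (IsLocalMin.deriv_eq_zero (Filter.Eventually.of_forall fun x => ?_)).le
      simp [hz]
    · linarith [hr (lt_of_le_of_lt ha har) hz])
  simp only
  linarith

end GradientFlowSol

/-- sharp two-sided bounds near extinction: with `T_ex` the extinction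
time, for every `t ∈ [0, T_ex)` with `u(t) ≠ 0` one has
`λ₁(T_ex − t) ≤ ‖u(t)‖ ≤ (J(u(t))/‖u(t)‖)·(T_ex − t)`, the right-hand inequality
being read as trivially true when `J(u(t)) = +∞`. -/
theorem gradient_flow_extinction_profile {H : Type*} [NormedAddCommGroup H]
    [InnerProductSpace ℝ H] [CompleteSpace H] (J : H → ℝ≥0∞)
    (hproper : IsProperFn J) (hconv : IsConvexFn J) (hlsc : LowerSemicontinuous J)
    (hhom : AbsOneHomogeneous J) (lam : ℝ) (hlam : 0 < lam) (hcoer : CoerciveWith J lam)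
    (u₀ : H) (hperp : PerpNullSpace J u₀)
    (S : GradientFlowSol J) (hinit : S.u 0 = u₀)
    (Tex : ℝ) (hTex : Tex = sInf {T : ℝ | 0 ≤ T ∧ ∀ t : ℝ, T ≤ t → S.u t = 0}) :
    ∀ t : ℝ, 0 ≤ t → t < Tex → S.u t ≠ 0 →
      lam * (Tex - t) ≤ ‖S.u t‖ ∧
      (J (S.u t) ≠ ⊤ → ‖S.u t‖ ≤ (J (S.u t)).toReal / ‖S.u t‖ * (Tex - t)) := by
  intro t ht htT hne
  have h0 : PerpNullSpace J (S.u 0) := hinit ▸ hperp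
  have hanti := S.norm_antitoneOn hhom hlam.le hcoer h0
  set A : Set ℝ := {T : ℝ | 0 ≤ T ∧ ∀ t : ℝ, T ≤ t → S.u t = 0}
  have hbdd : BddBelow A := ⟨0, fun _ hx => hx.1⟩
  have hzero : ∀ s, 0 ≤ s → S.u s = 0 → Tex ≤ s := by
    intro s hs hus
    rw [hTex]
    refine csInf_le hbdd ⟨hs, fun r hr => ?_⟩
    have := hanti (Set.mem_Ici.2 hs) (Set.mem_Ici.2 (hs.trans hr)) hr
    simpa [hus] using this
  have hpos : 0 < ‖S.u t‖ := norm_pos_iff.2 hne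
  refine ⟨?_, fun hfin => ?_⟩
  · by_contra! hcon
    have hdiv : ‖S.u t‖ / lam < Tex - t := by
      rwa [div_lt_iff₀ hlam, mul_comm]
    have hdpos : 0 < ‖S.u t‖ / lam := by positivity
    have := S.norm_sub_le_of_deriv_le (a := t) (b := t + ‖S.u t‖ / lam) (c := -lam) ht
      (by linarith) (by
        filter_upwards [S.deriv_norm_le hhom hcoer h0] with r hr htr hrb
        exact hr (ht.trans_lt htr) fun hz => by linarith [hzero r (by linarith) hz])
    rw [add_sub_cancel_left, neg_mul, mul_div_cancel₀ _ hlam.ne'] at this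
    have hz : S.u (t + ‖S.u t‖ / lam) = 0 :=
      norm_le_zero_iff.1 (by linarith)
    linarith [hzero _ (by linarith) hz]
  · have hT0 : 0 ≤ Tex := ht.trans htT.le
    have hAne : A.Nonempty := by
      by_contra hemp
      rw [Set.not_nonempty_iff_eq_empty] at hemp
      rw [hemp, Real.sInf_empty] at hTex
      linarith
    have huT : S.u Tex = 0 := by
      refine tendsto_nhds_unique (S.tendsto_nhdsGT hT0) ?_
      refine tendsto_const_nhds.congr' ?_
      filter_upwards [self_mem_nhdsWithin] with s hs
      obtain ⟨T, hTA, hTs⟩ := (csInf_lt_iff hbdd hAne).1 (hTex ▸ (hs : Tex < s))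
      exact (hTA.2 s hTs.le).symm
    have := S.inner_sub_le (w := S.u t) (c := (J (S.u t)).toReal) (by
      filter_upwards [S.subdiff_ae] with r hr hr0
      exact ((hr hr0).euler_and_inner_le hhom).2.2 _ hfin) ht htT.le
    rw [huT, sub_zero, real_inner_self_eq_norm_sq] at this
    rw [div_mul_eq_mul_div, le_div_iff₀ hpos]
    nlinarith
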